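/- arXiv:2210.14006 — 6 statements merged into one kernel-verified Lean document; each statement's English description precedes it below -/
import Mathlib

section
/- Let c ∈ {0,1}^n and let {j₁,j₂}, {j₁',j₂'} ⊆ [n] with j₁ < j₂, j₁' < j₂' and j₁ ≤ j₁'. If the string obtained from c by deleting positions j₁ and j₂ equals the string obtained from c by deleting positions j₁' and j₂', then one of the following holds: (1) c_{j₁} and c_{j₁'} lie in the same run of c, and c_{j₂} and c_{j₂'} lie in the same run of c; or (2) there is an alternative substring c_{[s₁,s₂]} of c of length at least 3 such that c_{j₁} and c_{s₁} lie in the same run of c, j₂ = s₁ + 1, j₁' = s₂ − 1, and c_{j₂'} and c_{s₂} lie in the same run of c. -/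
/-- `IsRunItv c a b` : positions `a..b` (0-indexed, inclusive) form a run of `c`,
i.e. a maximal interval of identical symbols. -/
def IsRunItv (c : List Bool) (a b : ℕ) : Prop :=
  a ≤ b ∧ b < c.length ∧
  (∀ i, a ≤ i → i ≤ b → c.getD i false = c.getD a false) ∧
  (a = 0 ∨ c.getD (a - 1) false ≠ c.getD a false) ∧
  (b = c.length - 1 ∨ c.getD (b + 1) false ≠ c.getD b false)

/-- Two positions lie in the same run of `c`. -/
def SameRun (c : List Bool) (i j : ℕ) : Prop :=
  ∃ a b : ℕ, IsRunItv c a b ∧ a ≤ i ∧ i ≤ b ∧ a ≤ j ∧ j ≤ b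

/-- `IsAlt c s₁ s₂` : positions `s₁..s₂` (0-indexed, `s₁ < s₂`) form an
alternative substring of `c` (consecutive symbols differ). -/
def IsAlt (c : List Bool) (s₁ s₂ : ℕ) : Prop :=
  s₁ < s₂ ∧ s₂ < c.length ∧
  ∀ i, s₁ ≤ i → i < s₂ → c.getD (i + 1) false ≠ c.getD i false

/-- Delete the symbols at positions `j₁ < j₂` (0-indexed) from `c`. -/
def delete2 {α : Type*} (c : List α) (j₁ j₂ : ℕ) : List α :=
  (c.eraseIdx j₂).eraseIdx j₁

theorem SameRun.symm {c : List Bool} {i j : ℕ} (h : SameRun c i j) : SameRun c j i := by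
  obtain ⟨a, b, hr, h₁, h₂, h₃, h₄⟩ := h
  exact ⟨a, b, hr, h₃, h₄, h₁, h₂⟩

/-- The endpoints of an interval on which consecutive symbols agree lie in the same run. -/
theorem sameRun_of_forall_succ_eq {c : List Bool} {i j : ℕ} (hij : i ≤ j) (hj : j < c.length)
    (h : ∀ k, i ≤ k → k < j → c.getD (k + 1) false = c.getD k false) : SameRun c i j := by
  classical
  have hleft : ∃ a, ∀ k, a ≤ k → k < j → c.getD (k + 1) false = c.getD k false := ⟨i, h⟩
  obtain ⟨a, ha, hmin⟩ : ∃ a, (∀ k, a ≤ k → k < j → c.getD (k + 1) false = c.getD k false) ∧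
      ∀ m < a, ¬ ∀ k, m ≤ k → k < j → c.getD (k + 1) false = c.getD k false :=
    ⟨Nat.find hleft, Nat.find_spec hleft, fun m hm => Nat.find_min hleft hm⟩
  have hai : a ≤ i := not_lt.1 fun hlt => hmin i hlt h
  have hright : ∃ b, j ≤ b ∧ (b = c.length - 1 ∨ c.getD (b + 1) false ≠ c.getD b false) :=
    ⟨c.length - 1, by omega, Or.inl rfl⟩
  obtain ⟨b, ⟨hjb, hb⟩, hbmin⟩ : ∃ b,
      (j ≤ b ∧ (b = c.length - 1 ∨ c.getD (b + 1) false ≠ c.getD b false)) ∧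
      ∀ m < b, ¬ (j ≤ m ∧ (m = c.length - 1 ∨ c.getD (m + 1) false ≠ c.getD m false)) :=
    ⟨Nat.find hright, Nat.find_spec hright, fun m hm => Nat.find_min hright hm⟩
  have hbn : b ≤ c.length - 1 :=
    not_lt.1 fun hlt => hbmin (c.length - 1) hlt ⟨by omega, Or.inl rfl⟩
  have hstep : ∀ k, a ≤ k → k < b → c.getD (k + 1) false = c.getD k false := by
    intro k hak hkb
    rcases lt_or_ge k j with hk | hk
    · exact ha k hak hk
    · by_contra hne
      exact hbmin k hkb ⟨hk, Or.inr hne⟩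
  refine ⟨a, b, ⟨by omega, by omega, ?_, ?_, hb⟩, by omega, by omega, by omega, by omega⟩
  · intro k hak
    induction k, hak using Nat.le_induction with
    | base => intro _; rfl
    | succ k hak ih => intro hkb; rw [hstep k hak (by omega), ih (by omega)]
  · rcases Nat.eq_zero_or_pos a with h0 | hpos
    · exact Or.inl h0
    · right
      intro heq
      refine hmin (a - 1) (by omega) fun k hk hkj => ?_
      rcases Nat.lt_or_ge k a with hka | hka
      · obtain rfl : k = a - 1 := by omega
        rw [heq, Nat.sub_add_cancel hpos]
      · exact ha k hka hkj

theorem getD_delete2 {α : Type*} (c : List α) (d : α) {i j : ℕ} (hij : i < j) (k : ℕ) :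
    (delete2 c i j).getD k d =
      if k < i then c.getD k d else if k + 1 < j then c.getD (k + 1) d else c.getD (k + 2) d := by
  simp only [delete2, List.getD_eq_getElem?_getD, List.getElem?_eraseIdx]
  split_ifs <;> first | rfl | omega

theorem stmt_8 (c : List Bool) (j₁ j₂ j₁' j₂' : ℕ)
    (h12 : j₁ < j₂) (h12' : j₁' < j₂') (h11 : j₁ ≤ j₁')
    (hj₂ : j₂ < c.length) (hj₂' : j₂' < c.length)
    (heq : delete2 c j₁ j₂ = delete2 c j₁' j₂') :
    (SameRun c j₁ j₁' ∧ SameRun c j₂ j₂') ∨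
    (∃ s₁ s₂ : ℕ, IsAlt c s₁ s₂ ∧ s₁ + 2 ≤ s₂ ∧ SameRun c j₁ s₁ ∧
      j₂ = s₁ + 1 ∧ j₁' = s₂ - 1 ∧ SameRun c j₂' s₂) := by
  have hget (k : ℕ) := congrArg (fun l => l.getD k false) heq
  simp only [getD_delete2 c false h12, getD_delete2 c false h12'] at hget
  generalize hf : (fun k => c.getD k false) = f
  replace hf (k : ℕ) : c.getD k false = f k := congrFun hf k
  simp only [hf] at hget
  rcases Nat.lt_or_ge j₁' j₂ with hlt | hge
  · left
    constructor
    · refine sameRun_of_forall_succ_eq h11 (by omega) fun k hk hk' => ?_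
      grind
    · have hstep (k : ℕ) (hk : min j₂ j₂' ≤ k) (hk' : k < max j₂ j₂') :
          c.getD (k + 1) false = c.getD k false := by
        have := hget (k - 1)
        have e₁ : k - 1 + 1 = k := by omega
        have e₂ : k - 1 + 2 = k + 1 := by omega
        grind
      rcases le_total j₂ j₂' with hle | hle
      · exact sameRun_of_forall_succ_eq hle hj₂' fun k _ _ => hstep k (by omega) (by omega)
      · exact (sameRun_of_forall_succ_eq hle hj₂ fun k _ _ => hstep k (by omega) (by omega)).symm
  · have hpre (k : ℕ) (hk : j₁ ≤ k) (hk' : k < j₂ - 1) : f (k + 1) = f k := by grind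
    have hmid (k : ℕ) (hk : j₂ - 1 ≤ k) (hk' : k < j₁') : f (k + 2) = f k := by grind
    have hpost (k : ℕ) (hk : j₁' + 1 ≤ k) (hk' : k < j₂') : f (k + 1) = f k := by
      have := hget (k - 1)
      have e₁ : k - 1 + 1 = k := by omega
      have e₂ : k - 1 + 2 = k + 1 := by omega
      grind
    have hiff (k : ℕ) (hk : j₂ - 1 ≤ k) :
        k ≤ j₁' → (f (k + 1) = f k ↔ f (j₂ - 1 + 1) = f (j₂ - 1)) := by
      induction k, hk using Nat.le_induction with
      | base => intro _; rfl
      | succ k hk ih =>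
        intro hk'
        rw [← ih (by omega), hmid k hk (by omega)]
        exact eq_comm
    by_cases heq₂ : f (j₂ - 1 + 1) = f (j₂ - 1)
    · left
      have hstep (k : ℕ) (hk : j₁ ≤ k) (hk' : k < j₂') :
          c.getD (k + 1) false = c.getD k false := by
        rw [hf, hf]
        rcases Nat.lt_or_ge k (j₂ - 1) with h | h
        · exact hpre k hk h
        · rcases Nat.lt_or_ge j₁' k with h' | h'
          · exact hpost k h' hk'
          · exact (hiff k h h').2 heq₂
      exact ⟨sameRun_of_forall_succ_eq h11 (by omega) fun k _ _ => hstep k (by omega) (by omega),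
        sameRun_of_forall_succ_eq (by omega) hj₂' fun k _ _ => hstep k (by omega) (by omega)⟩
    · right
      refine ⟨j₂ - 1, j₁' + 1, ⟨by omega, by omega, fun k hk hk' => ?_⟩, by omega, ?_, by omega,
        by omega, ?_⟩
      · rw [hf, hf]
        exact fun h => heq₂ ((hiff k hk (by omega)).1 h)
      · exact sameRun_of_forall_succ_eq (by omega) (by omega) fun k hk hk' => by
          rw [hf, hf]; exact hpre k hk hk'
      · exact (sameRun_of_forall_succ_eq (by omega) hj₂' fun k hk hk' => by
          rw [hf, hf]; exact hpost k hk hk').symm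
end

section
/- Let t ≥ 1, let p = 0^t1^t and δ = t·2^{t+1}·⌈log₂ n⌉, and suppose c ∈ {0,1}^n is (p, δ)-dense. Let b ∈ B_{≤t}(c). Then there exists an interval K ⊆ [n] of length at most δ − 1 such that for every interval D ⊆ [n] with b equal to c restricted to [n]∖D, one has D ⊆ K. -/
/-- `Bset t x` : strings obtained from `x` by deleting a burst of at most `t`
consecutive symbols. -/
def Bset {α : Type*} (t : ℕ) (x : List α) : Set (List α) :=
  {y | ∃ u v w : List α, x = u ++ v ++ w ∧ y = u ++ w ∧ v.length ≤ t}

/-- A binary string `c` is `(p, δ)`-dense if every substring of `c` of length `δ`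
contains `p` as a substring. -/
def DenseStr (p : List Bool) (δ : ℕ) (c : List Bool) : Prop :=
  ∀ v : List Bool, v.IsInfix c → v.length = δ → p.IsInfix v

/-- The pattern `0^t 1^t`. -/
def pat (t : ℕ) : List Bool := List.replicate t false ++ List.replicate t true

theorem pat_getElem?_false {t j : ℕ} (h : j < t) : (pat t)[j]? = some false := by
  simp [pat, List.getElem?_append, h]

theorem pat_getElem?_true {t j : ℕ} (h₁ : t ≤ j) (h₂ : j < 2 * t) :
    (pat t)[j]? = some true := by
  have h : j - t < t := by omega
  simp [pat, List.getElem?_append, Nat.not_lt.mpr h₁, h]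

theorem pat_length (t : ℕ) : (pat t).length = 2 * t := by
  simp [pat, two_mul]

/-- If deleting `l` consecutive symbols of `x` at positions `i` and `i'` gives the same string,
then `x` has period `l` between `i` and `i' + l`. -/
theorem getElem?_add_eq_of_take_append_drop_eq {α : Type*} {x : List α} {i i' l : ℕ}
    (hi' : i' ≤ x.length)
    (h : x.take i ++ x.drop (i + l) = x.take i' ++ x.drop (i' + l))
    {j : ℕ} (hij : i ≤ j) (hj : j < i') : x[j + l]? = x[j]? := by
  have hl : (x.take i ++ x.drop (i + l))[j]? = x[j + l]? := by
    rw [List.getElem?_append_right (by simp; omega), List.getElem?_drop, List.length_take,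
      min_eq_left (by omega)]
    congr 1
    omega
  have hr : (x.take i' ++ x.drop (i' + l))[j]? = x[j]? := by
    rw [List.getElem?_append_left (by simp; omega), List.getElem?_take_of_lt hj]
  rw [← hl, h, hr]

/-- In a string which is dense for `pat t`, two deletions of `l ≤ t` consecutive symbols with
the same result span fewer than `δ` positions. -/
theorem DenseStr.span_lt {t δ : ℕ} (ht : 1 ≤ t) {x : List Bool} (hdense : DenseStr (pat t) δ x)
    {i i' l : ℕ} (hl : 1 ≤ l) (hlt : l ≤ t) (hi : i ≤ i') (hi' : i' + l ≤ x.length)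
    (h : x.take i ++ x.drop (i + l) = x.take i' ++ x.drop (i' + l)) :
    i' + l - i < δ := by
  by_contra! hδ
  obtain ⟨s, r, hsr⟩ := hdense ((x.drop i).take δ)
    ((List.take_prefix _ _).isInfix.trans (List.drop_suffix _ _).isInfix)
    (by simp; omega)
  have hlen := congrArg List.length hsr
  simp only [List.length_append, pat_length, List.length_take, List.length_drop] at hlen
  have key : ∀ m, m < 2 * t → x[i + s.length + m]? = (pat t)[m]? := by
    intro m hm
    have hv : ((x.drop i).take δ)[s.length + m]? = x[i + s.length + m]? := by
      rw [List.getElem?_take_of_lt (by omega), List.getElem?_drop, Nat.add_assoc]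
    rw [← hv, ← hsr, List.append_assoc, List.getElem?_append_right (by omega),
      Nat.add_sub_cancel_left, List.getElem?_append_left (by rw [pat_length]; exact hm)]
  have hper := getElem?_add_eq_of_take_append_drop_eq (by omega) h
    (j := i + s.length + (t - 1)) (by omega) (by omega)
  rw [Nat.add_assoc _ (t - 1) l, key (t - 1 + l) (by omega), key (t - 1) (by omega),
    pat_getElem?_true (by omega) (by omega), pat_getElem?_false (by omega)] at hper
  simp at hper

theorem stmt_9 (t n : ℕ) (ht : 1 ≤ t) (c : List Bool) (hc : c.length = n)
    (hdense : DenseStr (pat t) (t * 2 ^ (t + 1) * Nat.clog 2 n) c)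
    (b : List Bool) (hb : b ∈ Bset t c) :
    ∃ k₁ k₂ : ℕ, k₁ ≤ k₂ ∧ k₂ < n ∧
      k₂ - k₁ + 1 ≤ t * 2 ^ (t + 1) * Nat.clog 2 n - 1 ∧
      ∀ i l : ℕ, i + l ≤ n → b = c.take i ++ c.drop (i + l) →
        ∀ j, i ≤ j → j < i + l → k₁ ≤ j ∧ j ≤ k₂ := by
  classical
  have hn : 2 ≤ n := by
    by_contra! h
    have h0 : t * 2 ^ (t + 1) * Nat.clog 2 n = 0 := by
      rw [Nat.clog_of_right_le_one (by omega), mul_zero]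
    have hp := (hdense [] List.nil_infix h0.symm).length_le
    rw [pat_length, List.length_nil] at hp
    omega
  set δ := t * 2 ^ (t + 1) * Nat.clog 2 n with hδ
  have hδ2 : 2 ≤ δ := by
    have h1 : 0 < Nat.clog 2 n := Nat.clog_pos (by norm_num) hn
    have h2 : 1 ≤ 2 ^ t := Nat.one_le_two_pow
    have h3 : 2 ≤ 2 ^ (t + 1) := by rw [pow_succ]; omega
    calc 2 = 1 * 2 * 1 := rfl
      _ ≤ δ := Nat.mul_le_mul (Nat.mul_le_mul ht h3) h1
  obtain ⟨u, v, w, hcu, hbu, hvt⟩ := hb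
  have hlen : u.length + v.length + w.length = n := by
    rw [← hc, hcu]; simp [Nat.add_assoc]
  have hl_eq : ∀ i l : ℕ, i + l ≤ n → b = c.take i ++ c.drop (i + l) → l = v.length := by
    intro i l hil hb
    have h := congrArg List.length hb
    rw [hbu] at h
    simp only [List.length_append, List.length_take, List.length_drop] at h
    omega
  rcases Nat.eq_zero_or_pos v.length with hv | hv
  · refine ⟨0, 0, le_rfl, by omega, by omega, fun i l hil hb j h₁ h₂ => ?_⟩
    have := hl_eq i l hil hb
    omega
  let S := (Finset.range (n + 1)).filter
    fun i => i + v.length ≤ n ∧ b = c.take i ++ c.drop (i + v.length)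
  have hmem : ∀ i, i ∈ S ↔ i + v.length ≤ n ∧ b = c.take i ++ c.drop (i + v.length) := by
    intro i
    simp only [S, Finset.mem_filter, Finset.mem_range, and_iff_right_iff_imp]
    omega
  have hS : S.Nonempty := by
    refine ⟨u.length, (hmem _).2 ⟨by omega, ?_⟩⟩
    rw [hbu, hcu, ← List.length_append, List.drop_left, List.append_assoc, List.take_left]
  obtain ⟨-, hmin⟩ := (hmem _).1 (S.min'_mem hS)
  obtain ⟨hmax_le, hmax⟩ := (hmem _).1 (S.max'_mem hS)
  have hle : S.min' hS ≤ S.max' hS := S.min'_le _ (S.max'_mem hS)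
  have hspan := hdense.span_lt ht hv hvt hle (by omega) (hmin.symm.trans hmax)
  refine ⟨S.min' hS, S.max' hS + v.length - 1, by omega, by omega, by omega, ?_⟩
  intro i l hil hb j h₁ h₂
  obtain rfl := hl_eq i l hil hb
  have hi : i ∈ S := (hmem i).2 ⟨hil, hb⟩
  have := S.min'_le i hi
  have := S.le_max' i hi
  omega
end

section
/- Let c ∈ {0,1}^n, let t' ≥ 1, and let D = [i₁, i₁+t'−1] and D' = [i₂, i₂+t'−1] be intervals contained in [n] with i₁ ≤ i₂. If the string obtained from c by deleting the positions in D equals the string obtained from c by deleting the positions in D', then c_i = c_{i+t'} for every i ∈ [i₁, i₂−1]; in particular the substring c_{[i₁, i₂+t'−1]} has period t'. -/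
theorem stmt_10 (n t' : ℕ) (ht' : 1 ≤ t') (c : List Bool) (hc : c.length = n)
    (i₁ i₂ : ℕ) (h₁ : i₁ + t' ≤ n) (h₂ : i₂ + t' ≤ n) (h12 : i₁ ≤ i₂)
    (heq : c.take i₁ ++ c.drop (i₁ + t') = c.take i₂ ++ c.drop (i₂ + t')) :
    ∀ i : ℕ, i₁ ≤ i → i < i₂ → c.getD i false = c.getD (i + t') false := by
  intro i hi hi'
  have h : (c.take i₁ ++ c.drop (i₁ + t'))[i]? = (c.take i₂ ++ c.drop (i₂ + t'))[i]? := by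
    rw [heq]
  rw [List.getElem?_append_right (by simp; omega), List.getElem?_append_left (by simp; omega),
    List.getElem?_drop, List.getElem?_take_of_lt hi', List.length_take,
    show i₁ + t' + (i - min i₁ c.length) = i + t' by omega] at h
  rw [List.getD_eq_getElem?_getD, List.getD_eq_getElem?_getD, h]
end

section
/- Let t ≥ 1, let p = 0^t1^t and δ be a positive integer, and suppose c ∈ {0,1}^n is (p, δ)-dense. Then for every t' with 1 ≤ t' ≤ t, every substring of c that has period t' has length at most δ − 1. -/
/-- A binary string `a` has period `ℓ` (with `ℓ ≤ a.length`):
`a_{i+ℓ} = a_i` for all valid `i` (0-indexed). -/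
def HasPeriod (a : List Bool) (ℓ : ℕ) : Prop :=
  ℓ ≤ a.length ∧ ∀ i : ℕ, i + ℓ < a.length → a.getD (i + ℓ) false = a.getD i false

theorem getD_append_pat_of_lt (s u : List Bool) {t i : ℕ} (hi : i < t) :
    (s ++ pat t ++ u).getD (s.length + i) false = false := by
  simp [pat, List.getD, List.getElem?_append, hi]

theorem getD_append_pat_of_le (s u : List Bool) {t i : ℕ} (hti : t ≤ i) (hi : i < 2 * t) :
    (s ++ pat t ++ u).getD (s.length + i) false = true := by
  have h : i - t < t := by omega
  simp [pat, List.getD, List.getElem?_append, h, hti.not_gt]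

/-- A string containing `0^t 1^t` has no period between `1` and `t`. -/
theorem not_hasPeriod_of_pat_isInfix {t l : ℕ} (hl : 1 ≤ l) (hlt : l ≤ t) {v : List Bool}
    (hv : (pat t).IsInfix v) : ¬ HasPeriod v l := by
  obtain ⟨s, u, rfl⟩ := hv
  rintro ⟨-, hper⟩
  have hlen : s.length + (t - 1) + l < (s ++ pat t ++ u).length := by
    simp only [pat, List.length_append, List.length_replicate]
    omega
  have h := hper (s.length + (t - 1)) hlen
  have h₀ := getD_append_pat_of_lt s u (t := t) (i := t - 1) (by omega)
  have h₁ := getD_append_pat_of_le s u (t := t) (i := t - 1 + l) (by omega) (by omega)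
  rw [add_assoc, h₁, h₀] at h
  exact Bool.noConfusion h

theorem stmt_11 (t δ n : ℕ) (ht : 1 ≤ t) (hδ : 1 ≤ δ) (c : List Bool)
    (hc : c.length = n) (hdense : DenseStr (pat t) δ c) :
    ∀ t' : ℕ, 1 ≤ t' → t' ≤ t →
      ∀ v : List Bool, v.IsInfix c → HasPeriod v t' → v.length ≤ δ - 1 := by
  intro l hl hlt v hv hper
  by_contra hlong
  have htake : (v.take δ).IsInfix v := (List.take_prefix δ v).isInfix
  have hpat := hdense (v.take δ) (htake.trans hv) (by rw [List.length_take]; omega)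
  exact not_hasPeriod_of_pat_isInfix hl hlt (hpat.trans htake) hper
end

section
/- Let c ∈ {0,1}^n and let j₁ < j₂ and j₁' < j₂' be positions in [n] with j₁ ≤ j₁' < j₂ ≤ j₂'. If the string obtained from c by deleting positions j₁ and j₂ equals the string obtained from c by deleting positions j₁' and j₂', then c_{j₁} = c_{j₁+1} = ⋯ = c_{j₁'} and c_{j₂} = c_{j₂+1} = ⋯ = c_{j₂'}. -/
theorem getElem?_delete2 {α : Type*} (l : List α) {j₁ j₂ : ℕ} (h : j₁ < j₂) (k : ℕ) :
    (delete2 l j₁ j₂)[k]? =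
      if k < j₁ then l[k]? else if k + 1 < j₂ then l[k + 1]? else l[k + 2]? := by
  simp only [delete2, List.getElem?_eraseIdx]
  split_ifs <;> first | rfl | omega

theorem getD_eq_of_forall_getElem?_succ {α : Type*} (l : List α) (d : α) {a b : ℕ}
    (h : ∀ k, a ≤ k → k < b → l[k + 1]? = l[k]?) (i : ℕ) (ha : a ≤ i) (hb : i ≤ b) :
    l.getD i d = l.getD a d := by
  induction i, ha using Nat.le_induction with
  | base => rfl
  | succ k hk ih =>
    rw [← ih (by omega), List.getD_eq_getElem?_getD, List.getD_eq_getElem?_getD, h k hk hb]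

theorem stmt_12 (c : List Bool) (j₁ j₂ j₁' j₂' : ℕ)
    (h1 : j₁ ≤ j₁') (h2 : j₁' < j₂) (h3 : j₂ ≤ j₂') (hj₂' : j₂' < c.length)
    (heq : delete2 c j₁ j₂ = delete2 c j₁' j₂') :
    (∀ i : ℕ, j₁ ≤ i → i ≤ j₁' → c.getD i false = c.getD j₁ false) ∧
    (∀ i : ℕ, j₂ ≤ i → i ≤ j₂' → c.getD i false = c.getD j₂ false) := by
  have key (k : ℕ) := congrArg (fun l : List Bool => l[k]?) heq
  simp only [getElem?_delete2 c (h1.trans_lt h2), getElem?_delete2 c (h2.trans_le h3)] at key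
  constructor
  · refine getD_eq_of_forall_getElem?_succ c false fun k hk hk' => ?_
    have := key k
    rwa [if_neg (by omega), if_pos (by omega), if_pos hk'] at this
  · refine getD_eq_of_forall_getElem?_succ c false fun k hk hk' => ?_
    obtain ⟨m, rfl⟩ : ∃ m, k = m + 1 := ⟨k - 1, by omega⟩
    have := key m
    rwa [if_neg (by omega), if_neg (by omega), if_neg (by omega), if_pos hk'] at this
end

section
/- For every n ≥ 1 and every a ∈ {0, 1, …, n}, the Varshamov–Tenengolts code VT_a(n) = { (c₁,…,c_n) ∈ {0,1}^n : Σ_{i=1}^n i·c_i ≡ a (mod n+1) } is a single-deletion correcting code: for any two distinct codewords c, c' ∈ VT_a(n), D₁(c) ∩ D₁(c') = ∅. -/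
/-- `Dset t x` : the set of subsequences of `x` obtained by deleting `t` symbols. -/
def Dset {α : Type*} (t : ℕ) (x : List α) : Set (List α) :=
  {y | y.Sublist x ∧ y.length + t = x.length}

/-- The VT syndrome `Σ_{i=1}^n i·c_i` of a binary string (1-indexed weights). -/
def vtSum (c : List Bool) : ℕ :=
  ∑ i ∈ Finset.range c.length, (i + 1) * (if c.getD i false then 1 else 0)

theorem vtSum_cons (b : Bool) (l : List Bool) :
    vtSum (b :: l) = vtSum l + l.count true + if b then 1 else 0 := by
  have hcount : ∀ l : List Bool,
      ∑ i ∈ Finset.range l.length, (if l.getD i false then 1 else 0) = l.count true := by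
    intro l
    induction l with
    | nil => simp
    | cons b l ih =>
      rw [List.length_cons, Finset.sum_range_succ']
      simp only [List.getD_cons_succ, List.getD_cons_zero, ih, List.count_cons]
      cases b <;> simp
  unfold vtSum
  rw [List.length_cons, Finset.sum_range_succ', ← hcount l, ← Finset.sum_add_distrib]
  simp only [List.getD_cons_succ, List.getD_cons_zero]
  congr 1
  · refine Finset.sum_congr rfl fun i _ => ?_
    ring
  · simp

theorem vtSum_append_cons (A B : List Bool) (b : Bool) :
    vtSum (A ++ b :: B) =
      vtSum (A ++ B) + B.count true + if b then A.length + 1 else 0 := by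
  induction A with
  | nil => simp [vtSum_cons]
  | cons x A ih =>
    simp only [List.cons_append, vtSum_cons, ih, List.count_append, List.count_cons,
      List.length_cons]
    cases b <;> simp <;> ring

theorem List.Sublist.exists_eq_append_cons {α : Type*} {y x : List α} (h : y.Sublist x)
    (hl : y.length + 1 = x.length) : ∃ A B b, y = A ++ B ∧ x = A ++ b :: B := by
  induction h with
  | slnil => simp at hl
  | @cons y x b h _ =>
    have : y = x := h.eq_of_length (by simpa using hl)
    exact ⟨[], x, b, by simpa using this, rfl⟩
  | @cons_cons y x b h ih =>
    obtain ⟨A, B, c, rfl, rfl⟩ := ih (by simpa using hl)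
    exact ⟨b :: A, B, c, rfl, rfl⟩

/-- Moving an inserted symbol across a block consisting only of that symbol does not change
the resulting string. -/
theorem List.append_cons_eq_of_count_eq {α : Type*} [DecidableEq α] {A B A' B' : List α} {b : α}
    (h : A ++ B = A' ++ B')
    (hc : B.length + B'.count b = B'.length + B.count b) :
    A ++ b :: B = A' ++ b :: B' := by
  have key : ∀ M : List α, M.length = M.count b → ∀ B : List α,
      b :: (M ++ B) = M ++ b :: B := by
    intro M hM B
    have hr : M = List.replicate M.length b :=
      List.eq_replicate_iff.2 ⟨rfl, fun x hx => (List.count_eq_length.1 hM.symm x hx).symm⟩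
    rw [hr, ← List.cons_append, ← List.replicate_succ, List.replicate_succ', List.append_assoc,
      List.singleton_append]
  rcases List.append_eq_append_iff.1 h with ⟨M, rfl, rfl⟩ | ⟨M, rfl, rfl⟩
  · simp only [List.length_append, List.count_append] at hc
    rw [key M (by omega), List.append_assoc]
  · simp only [List.length_append, List.count_append] at hc
    rw [key M (by omega), List.append_assoc]

theorem stmt_13 (n a : ℕ) (hn : 1 ≤ n) (ha : a ≤ n) :
    ∀ c c' : List Bool, c.length = n → c'.length = n →
      vtSum c ≡ a [MOD n + 1] → vtSum c' ≡ a [MOD n + 1] →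
      c ≠ c' → Dset 1 c ∩ Dset 1 c' = ∅ := by
  intro c c' hc hc' hs hs' hne
  rw [Set.eq_empty_iff_forall_notMem]
  rintro y ⟨⟨hy, hyl⟩, ⟨hy', hyl'⟩⟩
  apply hne
  obtain ⟨A, B, b, hAB, rfl⟩ := hy.exists_eq_append_cons hyl
  obtain ⟨A', B', b', hAB', rfl⟩ := hy'.exists_eq_append_cons hyl'
  have h : A ++ B = A' ++ B' := hAB.symm.trans hAB'
  have hmod := hs.trans hs'.symm
  rw [vtSum_append_cons, vtSum_append_cons, h, add_assoc, add_assoc] at hmod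
  have hmod := Nat.ModEq.add_left_cancel' _ hmod
  simp only [List.length_append, List.length_cons] at hc hc'
  have hcount := congrArg (List.count true) h
  simp only [List.count_append] at hcount
  have hA := List.count_le_length (a := true) (l := A)
  have hA' := List.count_le_length (a := true) (l := A')
  have hB := List.count_le_length (a := true) (l := B)
  have hB' := List.count_le_length (a := true) (l := B')
  have heq := Nat.ModEq.eq_of_lt_of_lt hmod (by split_ifs <;> omega) (by split_ifs <;> omega)
  have hf := List.count_true_add_count_false B
  have hf' := List.count_true_add_count_false B'
  cases b <;> cases b' <;> simp at heq
  · exact List.append_cons_eq_of_count_eq h (by omega)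
  · omega
  · omega
  · exact List.append_cons_eq_of_count_eq h (by omega)
end
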